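/- arXiv:2008.09781 — 2 statements merged into one kernel-verified Lean document; each statement's English description precedes it below -/
import Mathlib

section
/- Let Ω ⊆ ℝⁿ be a nonempty closed convex set, f : ℝⁿ → ℝ continuously differentiable, x* ∈ Ω, δ > 0, η > f(x*), a, b > 0, and let φ be a desingularizing function on [0, η − f(x*)); set α(t) = (b/√a)·φ'(t). Assume f satisfies the KL inequality w.r.t. x*: for every x ∈ Ω ∩ B_δ(x*) with f(x*) < f(x) < η, φ'(f(x) − f(x*))·π_x(−∇f(x)) ≥ 1. Let {x_k}, {x̃_k} ⊆ Ω satisfy for every k: f(x_{k+1}) + a‖x_{k+1} − x_k‖² ≤ f(x_k); f(x_k) − f(x_{k+1}) ≥ (a/b²)·π_{x̃_k}(−∇f(x̃_k))²; f(x_{k+1}) ≤ f(x̃_k) ≤ f(x_k) − a‖x̃_k − x_k‖². Assume moreover f(x*) ≤ f(x₀) < η; that x_k ∈ B_δ(x*) implies f(x_{k+1}) ≥ f(x*); and that (b/a)·φ(f(x₀) − f(x*)) + 2√((f(x₀) − f(x*) − σ_α(f(x₀) − f(x*)))/a) + ‖x₀ − x*‖ < δ. Then {x_k} ⊆ B_δ(x*),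 {x_k} converges to some x̃* with f(x̃*) ≤ f(x*), and for every k: f(x_k) − f(x*) ≤ σ_α^{(k)}(f(x₀) − f(x*)) and ‖x_k − x̃*‖ ≤ Σ_{i=k}^∞ ‖x_i − x_{i+1}‖ ≤ (b/a)·φ(f(x_k) − f(x*)) + 2√((f(x_k) − f(x*) − σ_α(f(x_k) − f(x*)))/a). -/
open scoped RealInnerProductSpace ENNReal

/-- The normal cone to a convex set `Ω` at a point `x`. -/
def normalCone {E : Type*} [NormedAddCommGroup E] [InnerProductSpace ℝ E]
    (Ω : Set E) (x : E) : Set E :=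
  {v | ∀ y ∈ Ω, ⟪v, y - x⟫ ≤ 0}

/-- `π_x(g) = dist(g, N_Ω(x))`. -/
noncomputable def piDist {E : Type*} [NormedAddCommGroup E] [InnerProductSpace ℝ E]
    (Ω : Set E) (x g : E) : ℝ :=
  Metric.infDist g (normalCone Ω x)

/-- The worst-case one-dimensional map `σ_α(t) = max{ s ∈ [0,t] : 1/α(s)² ≤ t − s }`
(maximum of the empty set taken as `0`; the convention `1/∞ = 0` is built into `ℝ≥0∞`). -/
noncomputable def sigmaAlpha (α : ℝ → ℝ≥0∞) (t : ℝ) : ℝ :=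
  sSup {s : ℝ | s ∈ Set.Icc 0 t ∧ (α s)⁻¹ ^ 2 ≤ ENNReal.ofReal (t - s)}

/-- The function `α(t) = (b/√a)·φ'(t)` for `t > 0`, extended by `∞` at `t ≤ 0`. -/
noncomputable def klAlpha (a b : ℝ) (φ' : ℝ → ℝ) : ℝ → ℝ≥0∞ :=
  fun t => if 0 < t then ENNReal.ofReal ((b / Real.sqrt a) * φ' t) else ⊤

section ConcaveTangent

variable {φ φ' : ℝ → ℝ} {R : ℝ}

lemma ConcaveOn.le_tangent (hconc : ConcaveOn ℝ (Set.Ico 0 R) φ)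
    (hderiv : ∀ t ∈ Set.Ioo 0 R, HasDerivAt φ (φ' t) t)
    {s t : ℝ} (hs : s ∈ Set.Ico 0 R) (ht : t ∈ Set.Ioo 0 R) :
    φ s ≤ φ t + φ' t * (s - t) := by
  have ht' : t ∈ Set.Ico 0 R := ⟨ht.1.le, ht.2⟩
  rcases lt_trichotomy s t with h | rfl | h
  · have := hconc.le_slope_of_hasDerivAt hs ht' h (hderiv t ht)
    rw [slope_def_field, le_div_iff₀ (sub_pos.2 h)] at this
    linarith
  · simp
  · have := hconc.slope_le_of_hasDerivAt ht' hs h (hderiv t ht)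
    rw [slope_def_field, div_le_iff₀ (sub_pos.2 h)] at this
    linarith

lemma ConcaveOn.antitoneOn_of_hasDerivAt (hconc : ConcaveOn ℝ (Set.Ico 0 R) φ)
    (hderiv : ∀ t ∈ Set.Ioo 0 R, HasDerivAt φ (φ' t) t) :
    AntitoneOn φ' (Set.Ioo 0 R) := by
  intro s hs t ht hst
  rcases hst.eq_or_lt with rfl | hlt
  · exact le_rfl
  have h₁ := hconc.le_tangent hderiv ⟨hs.1.le, hs.2⟩ ht
  have h₂ := hconc.le_tangent hderiv ⟨ht.1.le, ht.2⟩ hs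
  by_contra! h
  nlinarith [mul_pos (sub_pos.2 h) (sub_pos.2 hlt)]

lemma ConcaveOn.monotoneOn_of_hasDerivAt_pos (hconc : ConcaveOn ℝ (Set.Ico 0 R) φ)
    (hderiv : ∀ t ∈ Set.Ioo 0 R, HasDerivAt φ (φ' t) t)
    (hpos : ∀ t ∈ Set.Ioo 0 R, 0 < φ' t) : MonotoneOn φ (Set.Ico 0 R) := by
  intro s hs t ht hst
  rcases hst.eq_or_lt with rfl | hlt
  · exact le_rfl
  have ht' : t ∈ Set.Ioo 0 R := ⟨hs.1.trans_lt hlt, ht.2⟩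
  have h := hconc.le_tangent hderiv hs ht'
  nlinarith [mul_pos (hpos t ht') (sub_pos.2 hlt)]

end ConcaveTangent

section SigmaAlpha

variable {α : ℝ → ℝ≥0∞}

lemma sigmaAlpha_bddAbove (α : ℝ → ℝ≥0∞) (t : ℝ) :
    BddAbove {s : ℝ | s ∈ Set.Icc 0 t ∧ (α s)⁻¹ ^ 2 ≤ ENNReal.ofReal (t - s)} :=
  ⟨t, fun _ hs => hs.1.2⟩

lemma le_sigmaAlpha {s t : ℝ} (hs : s ∈ Set.Icc 0 t)
    (h : (α s)⁻¹ ^ 2 ≤ ENNReal.ofReal (t - s)) : s ≤ sigmaAlpha α t :=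
  le_csSup (sigmaAlpha_bddAbove α t) ⟨hs, h⟩

lemma sigmaAlpha_nonneg (α : ℝ → ℝ≥0∞) (t : ℝ) : 0 ≤ sigmaAlpha α t :=
  Real.sSup_nonneg fun _ hs => hs.1.1

lemma sigmaAlpha_le {t : ℝ} (ht : 0 ≤ t) : sigmaAlpha α t ≤ t :=
  Real.sSup_le (fun _ hs => hs.1.2) ht

lemma sigmaAlpha_mono (hα : α 0 = ⊤) {s t : ℝ} (hs : 0 ≤ s) (hst : s ≤ t) :
    sigmaAlpha α s ≤ sigmaAlpha α t := by
  refine csSup_le_csSup (sigmaAlpha_bddAbove α t) ⟨0, ⟨le_rfl, hs⟩, by simp [hα]⟩ ?_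
  rintro u ⟨hu, h⟩
  exact ⟨⟨hu.1, hu.2.trans hst⟩, h.trans (ENNReal.ofReal_le_ofReal (by linarith))⟩

end SigmaAlpha

section KLAlpha

variable {φ φ' : ℝ → ℝ} {R a b : ℝ}

lemma klAlpha_zero (a b : ℝ) (φ' : ℝ → ℝ) : klAlpha a b φ' 0 = ⊤ := by simp [klAlpha]

lemma klAlpha_inv_sq_le_iff (ha : 0 < a) (hb : 0 < b) {s t : ℝ} (hs : 0 < s) (hst : s ≤ t)
    (hφ' : 0 < φ' s) :
    (klAlpha a b φ' s)⁻¹ ^ 2 ≤ ENNReal.ofReal (t - s) ↔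
      1 ≤ b * φ' s * Real.sqrt ((t - s) / a) := by
  have hsa := Real.sqrt_pos.2 ha
  have hc : 0 < b / Real.sqrt a * φ' s := by positivity
  have hst' : 0 ≤ t - s := sub_nonneg.2 hst
  rw [klAlpha, if_pos hs, ← ENNReal.ofReal_inv_of_pos hc, ← ENNReal.ofReal_pow (by positivity),
    ENNReal.ofReal_le_ofReal_iff hst', ← Real.le_sqrt (by positivity) hst',
    inv_le_iff_one_le_mul₀' hc, Real.sqrt_div hst']
  have : b / Real.sqrt a * φ' s * Real.sqrt (t - s)
      = b * φ' s * (Real.sqrt (t - s) / Real.sqrt a) := by ring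
  rw [this]

lemma one_le_of_lt_sigmaAlpha (ha : 0 < a) (hb : 0 < b)
    (hanti : AntitoneOn φ' (Set.Ioo 0 R)) (hpos : ∀ t ∈ Set.Ioo 0 R, 0 < φ' t)
    {s r : ℝ} (hs : 0 < s) (hsr : s < sigmaAlpha (klAlpha a b φ') r) (hr : r < R) :
    1 ≤ b * φ' s * Real.sqrt ((r - s) / a) := by
  have hne : {s : ℝ | s ∈ Set.Icc 0 r ∧
      (klAlpha a b φ' s)⁻¹ ^ 2 ≤ ENNReal.ofReal (r - s)}.Nonempty := by
    by_contra hempty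
    rw [Set.not_nonempty_iff_eq_empty] at hempty
    rw [sigmaAlpha, hempty, Real.sSup_empty] at hsr
    exact absurd hsr hs.not_gt
  obtain ⟨u, ⟨⟨hu0, hur⟩, hu⟩, hsu⟩ := exists_lt_of_lt_csSup hne hsr
  have hu_pos : 0 < u := hs.trans hsu
  have hu_mem : u ∈ Set.Ioo 0 R := ⟨hu_pos, hur.trans_lt hr⟩
  have hs_mem : s ∈ Set.Ioo 0 R := ⟨hs, hsu.trans hu_mem.2⟩
  rw [klAlpha_inv_sq_le_iff ha hb hu_pos hur (hpos u hu_mem)] at hu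
  have hφ' := hanti hs_mem hu_mem hsu.le
  have := hpos s hs_mem
  refine hu.trans ?_
  gcongr

/-- The worst-case length bound dominates `(b/a)φ(s) + 2√((r-s)/a)` for every `s ≤ σ_α(r)`. -/
lemma phi_add_sqrt_le_of_le_sigmaAlpha (ha : 0 < a) (hb : 0 < b)
    (hconc : ConcaveOn ℝ (Set.Ico 0 R) φ)
    (hderiv : ∀ t ∈ Set.Ioo 0 R, HasDerivAt φ (φ' t) t)
    (hpos : ∀ t ∈ Set.Ioo 0 R, 0 < φ' t)
    {s r : ℝ} (hs : 0 ≤ s) (hsr : s ≤ sigmaAlpha (klAlpha a b φ') r)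
    (hr0 : 0 ≤ r) (hr : r < R) :
    b / a * φ s + 2 * Real.sqrt ((r - s) / a)
      ≤ b / a * φ r + 2 * Real.sqrt ((r - sigmaAlpha (klAlpha a b φ') r) / a) := by
  have hmono := hconc.monotoneOn_of_hasDerivAt_pos hderiv hpos
  have hσr : sigmaAlpha (klAlpha a b φ') r ≤ r := sigmaAlpha_le hr0
  have hba : 0 < b / a := by positivity
  rcases hsr.eq_or_lt with heq | hlt
  · rw [← heq]
    have := hmono ⟨hs, (hsr.trans hσr).trans_lt hr⟩ ⟨hr0, hr⟩ (hsr.trans hσr)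
    gcongr
  have hcont : ContinuousAt (fun v : ℝ => b / a * φ r + 2 * Real.sqrt ((r - v) / a))
      (sigmaAlpha (klAlpha a b φ') r) := by fun_prop
  refine ge_of_tendsto (hcont.tendsto.mono_left
    (nhdsWithin_le_nhds (s := Set.Iio (sigmaAlpha (klAlpha a b φ') r)))) ?_
  filter_upwards [Ioo_mem_nhdsLT hlt] with v hv
  have hv0 : 0 < v := hs.trans_lt hv.1
  have hvr : v < r := hv.2.trans_le hσr
  have hvR : v ∈ Set.Ioo 0 R := ⟨hv0, hvr.trans hr⟩
  have hone := one_le_of_lt_sigmaAlpha ha hb (hconc.antitoneOn_of_hasDerivAt hderiv) hpos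
    hv0 hv.2 hr
  have htan := hconc.le_tangent hderiv ⟨hs, hv.1.trans hvR.2⟩ hvR
  have hφ := hmono ⟨hv0.le, hvR.2⟩ ⟨hr0, hr⟩ hvr.le
  have hw2 : Real.sqrt ((r - v) / a) ^ 2 = (r - v) / a :=
    Real.sq_sqrt (div_nonneg (by linarith) ha.le)
  have hz2 : Real.sqrt ((r - s) / a) ^ 2 = (r - s) / a :=
    Real.sq_sqrt (div_nonneg (by linarith [hv.1]) ha.le)
  have hwz : Real.sqrt ((r - v) / a) ≤ Real.sqrt ((r - s) / a) := by
    have := hv.1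
    gcongr
  set w := Real.sqrt ((r - v) / a)
  set z := Real.sqrt ((r - s) / a)
  have hp := hpos v hvR
  have hw0 : 0 ≤ w := Real.sqrt_nonneg _
  have hdiff : b / a * (φ' v * (v - s)) = b * φ' v * ((z - w) * (z + w)) := by
    have : (z - w) * (z + w) = (v - s) / a := by
      calc (z - w) * (z + w) = z ^ 2 - w ^ 2 := by ring
        _ = (v - s) / a := by rw [hz2, hw2]; ring
    rw [this]; ring
  have h₁ : b / a * φ s ≤ b / a * φ v - b * φ' v * ((z - w) * (z + w)) := by
    rw [← hdiff, ← mul_sub]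
    gcongr
    linarith
  have h₂ : b / a * φ v ≤ b / a * φ r := by gcongr
  have h₃ : b * φ' v * ((z - w) * (2 * w)) ≤ b * φ' v * ((z - w) * (z + w)) := by
    have := sub_nonneg.2 hwz
    gcongr
    linarith
  nlinarith [mul_le_mul_of_nonneg_left hone (sub_nonneg.2 hwz)]

lemma sqrt_le_length_bound (ha : 0 < a) (hb : 0 < b)
    (hconc : ConcaveOn ℝ (Set.Ico 0 R) φ)
    (hderiv : ∀ t ∈ Set.Ioo 0 R, HasDerivAt φ (φ' t) t)
    (hpos : ∀ t ∈ Set.Ioo 0 R, 0 < φ' t) (hφ : ∀ t ∈ Set.Ico 0 R, 0 ≤ φ t)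
    {s r : ℝ} (hs : 0 ≤ s) (hsr : s ≤ r) (hr : r < R) :
    Real.sqrt ((r - s) / a)
      ≤ b / a * φ r + 2 * Real.sqrt ((r - sigmaAlpha (klAlpha a b φ') r) / a) := by
  have hr0 := hs.trans hsr
  have hba : 0 < b / a := by positivity
  rcases le_total s (sigmaAlpha (klAlpha a b φ') r) with h | h
  · have h₁ := phi_add_sqrt_le_of_le_sigmaAlpha ha hb hconc hderiv hpos hs h hr0 hr
    have h₂ := mul_nonneg hba.le (hφ s ⟨hs, hsr.trans_lt hr⟩)
    have h₃ := Real.sqrt_nonneg ((r - s) / a)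
    linarith
  · have h₁ : Real.sqrt ((r - s) / a)
        ≤ Real.sqrt ((r - sigmaAlpha (klAlpha a b φ') r) / a) := by gcongr
    have h₂ := mul_nonneg hba.le (hφ r ⟨hr0, hr⟩)
    have h₃ := Real.sqrt_nonneg ((r - s) / a)
    linarith

/-- One step of the length estimate: `q`, `r`, `p` are three consecutive values. -/
lemma two_mul_sqrt_le (ha : 0 < a) (hb : 0 < b)
    (hconc : ConcaveOn ℝ (Set.Ico 0 R) φ)
    (hderiv : ∀ t ∈ Set.Ioo 0 R, HasDerivAt φ (φ' t) t)
    (hpos : ∀ t ∈ Set.Ioo 0 R, 0 < φ' t)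
    {q r p : ℝ} (hp : 0 ≤ p) (hpr : p ≤ r) (hr : r < R)
    (hKL : 0 < r → 1 ≤ b * φ' r * Real.sqrt ((q - r) / a)) :
    2 * Real.sqrt ((r - p) / a) ≤ b / a * (φ r - φ p) + Real.sqrt ((q - r) / a) := by
  rcases (hp.trans hpr).eq_or_lt with h0 | hr0
  · obtain rfl : p = r := by linarith
    simp
  have hone := hKL hr0
  have hg := hpos r ⟨hr0, hr⟩
  have htan := hconc.le_tangent hderiv ⟨hp, hpr.trans_lt hr⟩ ⟨hr0, hr⟩
  have hv2 : Real.sqrt ((r - p) / a) ^ 2 = (r - p) / a :=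
    Real.sq_sqrt (div_nonneg (by linarith) ha.le)
  set v := Real.sqrt ((r - p) / a)
  set u := Real.sqrt ((q - r) / a)
  have hbg : 0 < b * φ' r := mul_pos hb hg
  have h₁ : b * φ' r * v ^ 2 ≤ b / a * (φ r - φ p) := by
    calc b * φ' r * v ^ 2 = b / a * (φ' r * (r - p)) := by rw [hv2]; ring
      _ ≤ _ := by gcongr; linarith
  have h₂ : 2 * v ≤ b * φ' r * v ^ 2 + u := by
    refine le_of_mul_le_mul_left ?_ hbg
    nlinarith [sq_nonneg (b * φ' r * v - 1)]
  linarith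

/-- Telescoped form of the length estimate. -/
lemma sum_sqrt_le (ha : 0 < a) (hb : 0 < b)
    (hconc : ConcaveOn ℝ (Set.Ico 0 R) φ)
    (hderiv : ∀ t ∈ Set.Ioo 0 R, HasDerivAt φ (φ' t) t)
    (hpos : ∀ t ∈ Set.Ioo 0 R, 0 < φ' t) {r : ℕ → ℝ} (hr : Antitone r) (k m : ℕ)
    (hR : r k < R) (hr0 : 0 ≤ r (k + m + 1))
    (hKL : ∀ i < m, 0 < r (k + i + 1) →
      1 ≤ b * φ' (r (k + i + 1)) * Real.sqrt ((r (k + i) - r (k + i + 1)) / a)) :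
    ∑ i ∈ Finset.range (m + 1), Real.sqrt ((r (k + i) - r (k + i + 1)) / a)
        + Real.sqrt ((r (k + m) - r (k + m + 1)) / a)
      ≤ b / a * (φ (r (k + 1)) - φ (r (k + m + 1)))
        + 2 * Real.sqrt ((r k - r (k + 1)) / a) := by
  induction m with
  | zero => simp; linarith
  | succ m ih =>
    have hm : r (k + m + 1 + 1) ≤ r (k + m + 1) := hr (Nat.le_succ _)
    have ih := ih (hr0.trans hm) fun i hi => hKL i (by omega)
    have hstep := two_mul_sqrt_le ha hb hconc hderiv hpos hr0 hm
      ((hr (show k ≤ k + m + 1 by omega)).trans_lt hR) (hKL m (by omega))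
    rw [Finset.sum_range_succ]
    simp only [← add_assoc] at ih hstep ⊢
    linarith

end KLAlpha

lemma piDist_nonneg {E : Type*} [NormedAddCommGroup E] [InnerProductSpace ℝ E]
    (Ω : Set E) (x g : E) : 0 ≤ piDist Ω x g :=
  Metric.infDist_nonneg

lemma norm_le_sqrt_div {E : Type*} [NormedAddCommGroup E] {a c : ℝ} (ha : 0 < a) {v : E}
    (h : a * ‖v‖ ^ 2 ≤ c) : ‖v‖ ≤ Real.sqrt (c / a) := by
  apply Real.le_sqrt_of_sq_le
  rw [le_div_iff₀ ha]
  linarith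

/-- Proposition 5.1 in the smooth constrained setting: under the KL inequality
w.r.t. `x*` on `B_δ(x*) ∩ [f(x*) < f < η]`, the descent conditions (H1), (H'2a), the sandwich
condition, the initialization, invariance and initial-distance conditions, the sequence stays
in `B_δ(x*)`, converges to some `x̃*` with `f(x̃*) ≤ f(x*)`, with rates
`f(x_k) − f(x*) ≤ σ_α^{(k)}(f(x₀) − f(x*))` and the tail length bound. -/
theorem kl_convergence_projection_free
    {n : ℕ} (Ω : Set (EuclideanSpace ℝ (Fin n)))
    (hne : Ω.Nonempty) (hcl : IsClosed Ω) (hconv : Convex ℝ Ω)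
    (f : EuclideanSpace ℝ (Fin n) → ℝ)
    (f' : EuclideanSpace ℝ (Fin n) → EuclideanSpace ℝ (Fin n))
    (hgrad : ∀ z, HasGradientAt f (f' z) z) (hf'cont : Continuous f')
    (xs : EuclideanSpace ℝ (Fin n)) (hxs : xs ∈ Ω)
    (δ : ℝ) (hδ : 0 < δ) (η : ℝ) (hη : f xs < η)
    (a b : ℝ) (ha : 0 < a) (hb : 0 < b)
    (φ φ' : ℝ → ℝ)
    (hφcont : ContinuousOn φ (Set.Ico 0 (η - f xs)))
    (hφconc : ConcaveOn ℝ (Set.Ico 0 (η - f xs)) φ)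
    (hφ0 : φ 0 = 0)
    (hφnonneg : ∀ t ∈ Set.Ico (0 : ℝ) (η - f xs), 0 ≤ φ t)
    (hφderiv : ∀ t ∈ Set.Ioo (0 : ℝ) (η - f xs), HasDerivAt φ (φ' t) t)
    (hφ'pos : ∀ t ∈ Set.Ioo (0 : ℝ) (η - f xs), 0 < φ' t)
    (hKL : ∀ z ∈ Ω, z ∈ Metric.ball xs δ → f xs < f z → f z < η →
      1 ≤ φ' (f z - f xs) * piDist Ω z (-f' z))
    (x xt : ℕ → EuclideanSpace ℝ (Fin n))
    (hxΩ : ∀ k, x k ∈ Ω) (hxtΩ : ∀ k, xt k ∈ Ω)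
    (hH1 : ∀ k, f (x (k + 1)) + a * ‖x (k + 1) - x k‖ ^ 2 ≤ f (x k))
    (hH'2a : ∀ k, f (x k) - f (x (k + 1)) ≥ (a / b ^ 2) * piDist Ω (xt k) (-f' (xt k)) ^ 2)
    (hsandwich : ∀ k, f (x (k + 1)) ≤ f (xt k) ∧ f (xt k) ≤ f (x k) - a * ‖xt k - x k‖ ^ 2)
    (hinit : f xs ≤ f (x 0)) (hinit' : f (x 0) < η)
    (hinv : ∀ k, x k ∈ Metric.ball xs δ → f xs ≤ f (x (k + 1)))
    (hcorcond : (b / a) * φ (f (x 0) - f xs)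
        + 2 * Real.sqrt ((f (x 0) - f xs - sigmaAlpha (klAlpha a b φ') (f (x 0) - f xs)) / a)
        + ‖x 0 - xs‖ < δ) :
    (∀ k, x k ∈ Metric.ball xs δ) ∧
    ∃ xlim : EuclideanSpace ℝ (Fin n),
      Filter.Tendsto x Filter.atTop (nhds xlim) ∧ f xlim ≤ f xs ∧
      ∀ k : ℕ,
        f (x k) - f xs ≤ (sigmaAlpha (klAlpha a b φ'))^[k] (f (x 0) - f xs) ∧
        Summable (fun i : ℕ => ‖x (k + i) - x (k + i + 1)‖) ∧
        ‖x k - xlim‖ ≤ ∑' i : ℕ, ‖x (k + i) - x (k + i + 1)‖ ∧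
        ∑' i : ℕ, ‖x (k + i) - x (k + i + 1)‖
          ≤ (b / a) * φ (f (x k) - f xs)
            + 2 * Real.sqrt ((f (x k) - f xs
                - sigmaAlpha (klAlpha a b φ') (f (x k) - f xs)) / a) := by
  set R := η - f xs with hR
  set σ := sigmaAlpha (klAlpha a b φ') with hσ
  set r : ℕ → ℝ := fun k => f (x k) - f xs with hr_def
  set u : ℕ → ℝ := fun k => Real.sqrt ((r k - r (k + 1)) / a) with hu_def
  have hba : 0 < b / a := by positivity
  have hr_anti : Antitone r := antitone_nat_of_succ_le fun k => by
    have := hH1 k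
    have : 0 ≤ a * ‖x (k + 1) - x k‖ ^ 2 := by positivity
    simp only [hr_def]
    linarith
  have hrR : ∀ k, r k < R := fun k =>
    (hr_anti (Nat.zero_le k)).trans_lt (by simp only [hr_def, hR]; linarith)
  have hr0 : 0 ≤ r 0 := sub_nonneg.2 hinit
  have hanti := hφconc.antitoneOn_of_hasDerivAt hφderiv
  have hstep : ∀ k, ‖x k - x (k + 1)‖ ≤ u k := fun k => by
    rw [norm_sub_rev]
    apply norm_le_sqrt_div ha
    have := hH1 k
    simp only [hr_def]
    linarith
  have hstep' : ∀ k, ‖x k - xt k‖ ≤ u k := fun k => by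
    rw [norm_sub_rev]
    apply norm_le_sqrt_div ha
    have := hsandwich k
    simp only [hr_def]
    linarith
  have hu0 : ∀ k, 0 ≤ u k := fun k => Real.sqrt_nonneg _
  have hKLstep : ∀ k, xt k ∈ Metric.ball xs δ → 0 < r (k + 1) →
      1 ≤ b * φ' (r (k + 1)) * u k := by
    intro k hball hpos
    obtain ⟨h₁, h₂⟩ := hsandwich k
    have hle : r (k + 1) ≤ f (xt k) - f xs := by simp only [hr_def]; linarith
    have hlt : f (xt k) - f xs < R := by
      have := hrR k
      have : 0 ≤ a * ‖xt k - x k‖ ^ 2 := by positivity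
      simp only [hr_def] at *
      linarith
    have hkl := hKL (xt k) (hxtΩ k) hball (by linarith) (by linarith)
    have hφ' := hanti ⟨hpos, hrR _⟩ ⟨hpos.trans_le hle, hlt⟩ hle
    have hπ := piDist_nonneg Ω (xt k) (-f' (xt k))
    have hdec := hH'2a k
    set π := piDist Ω (xt k) (-f' (xt k))
    have hπu : π / b ≤ u k := by
      apply Real.le_sqrt_of_sq_le
      rw [le_div_iff₀ ha]
      have : a / b ^ 2 * π ^ 2 = (π / b) ^ 2 * a := by ring
      simp only [hr_def]
      linarith
    have hp := hφ'pos _ ⟨hpos, hrR (k + 1)⟩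
    calc 1 ≤ φ' (f (xt k) - f xs) * π := hkl
      _ ≤ φ' (r (k + 1)) * π := by gcongr
      _ = b * φ' (r (k + 1)) * (π / b) := by field_simp
      _ ≤ b * φ' (r (k + 1)) * u k := by gcongr
  have hσstep : ∀ k, xt k ∈ Metric.ball xs δ → r (k + 1) ≤ σ (r k) := by
    intro k hball
    rcases le_or_gt (r (k + 1)) 0 with h | h
    · exact h.trans (sigmaAlpha_nonneg _ _)
    · have hle := hr_anti (Nat.le_succ k)
      exact le_sigmaAlpha ⟨h.le, hle⟩
        ((klAlpha_inv_sq_le_iff ha hb h hle (hφ'pos _ ⟨h, hrR _⟩)).2 (hKLstep k hball h))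
  have hlength : ∀ k m, (∀ i < m, xt (k + i) ∈ Metric.ball xs δ) → 0 ≤ r (k + m + 1) →
      ∑ i ∈ Finset.range (m + 1), u (k + i)
        ≤ b / a * φ (r k) + 2 * Real.sqrt ((r k - σ (r k)) / a) := by
    intro k m hball hnn
    have hrk1 : 0 ≤ r (k + 1) := hnn.trans (hr_anti (by omega))
    have hrk : 0 ≤ r k := hrk1.trans (hr_anti (by omega))
    rcases Nat.eq_zero_or_pos m with rfl | hm
    · simpa [hu_def] using sqrt_le_length_bound ha hb hφconc hφderiv hφ'pos hφnonneg hrk1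
        (hr_anti (Nat.le_succ k)) (hrR k)
    · have h₁ := sum_sqrt_le ha hb hφconc hφderiv hφ'pos hr_anti k m (hrR k) hnn
        fun i hi => hKLstep (k + i) (hball i hi)
      have h₂ := phi_add_sqrt_le_of_le_sigmaAlpha ha hb hφconc hφderiv hφ'pos hrk1
        (hσstep k (hball 0 hm)) hrk (hrR k)
      have h₃ := mul_nonneg hba.le (hφnonneg _ ⟨hnn, hrR _⟩)
      have h₄ := hu0 (k + m)
      simp only [hu_def] at h₄ ⊢
      linarith
  have hball : ∀ k, x k ∈ Metric.ball xs δ ∧ xt k ∈ Metric.ball xs δ := by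
    intro k
    induction k using Nat.strong_induction_on with
    | _ k ih =>
    have hnear : ∀ j, ‖x 0 - x j‖ ≤ ∑ i ∈ Finset.range j, u i := fun j => by
      rw [← dist_eq_norm]
      refine (dist_le_range_sum_dist x j).trans (Finset.sum_le_sum fun i _ => ?_)
      rw [dist_eq_norm]
      exact hstep i
    have hx : x k ∈ Metric.ball xs δ := by
      rw [mem_ball_iff_norm]
      rcases k with _ | k
      · have h₁ := mul_nonneg hba.le (hφnonneg _ ⟨hr0, hrR 0⟩)
        have h₂ := Real.sqrt_nonneg ((r 0 - σ (r 0)) / a)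
        simp only [hr_def] at h₁ h₂
        linarith
      · have h := hlength 0 k (fun i hi => (ih (0 + i) (by omega)).2)
          (sub_nonneg.2 (by simpa using hinv k (ih k (by omega)).1))
        simp only [zero_add] at h
        have h₁ := hnear (k + 1)
        have h₂ := norm_sub_le_norm_sub_add_norm_sub (x (k + 1)) (x 0) xs
        rw [norm_sub_rev (x (k + 1)) (x 0)] at h₂
        simp only [hr_def] at h
        linarith
    refine ⟨hx, ?_⟩
    rw [mem_ball_iff_norm]
    have h := hlength 0 k (fun i hi => (ih (0 + i) (by omega)).2)
      (sub_nonneg.2 (by simpa using hinv k hx))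
    simp only [zero_add, Finset.sum_range_succ] at h
    have h₁ := hnear k
    have h₂ := norm_sub_le_norm_sub_add_norm_sub (xt k) (x 0) xs
    have h₃ := norm_sub_le_norm_sub_add_norm_sub (x 0) (x k) (xt k)
    have h₄ := hstep' k
    rw [norm_sub_rev (xt k) (x 0)] at h₂
    simp only [hr_def] at h
    linarith
  have hr_nonneg : ∀ k, 0 ≤ r k := fun k => by
    rcases k with _ | k
    · exact hr0
    · exact sub_nonneg.2 (hinv k (hball k).1)
  have hsum : ∀ k m, ∑ i ∈ Finset.range m, ‖x (k + i) - x (k + i + 1)‖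
      ≤ b / a * φ (r k) + 2 * Real.sqrt ((r k - σ (r k)) / a) := fun k m =>
    calc ∑ i ∈ Finset.range m, ‖x (k + i) - x (k + i + 1)‖
        ≤ ∑ i ∈ Finset.range m, u (k + i) := Finset.sum_le_sum fun i _ => hstep (k + i)
      _ ≤ ∑ i ∈ Finset.range (m + 1), u (k + i) := by
        rw [Finset.sum_range_succ]
        linarith [hu0 (k + m)]
      _ ≤ _ := hlength k m (fun i _ => (hball _).2) (hr_nonneg _)
  have hsummable : ∀ k, Summable fun i => ‖x (k + i) - x (k + i + 1)‖ := fun k =>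
    summable_of_sum_range_le (fun _ => norm_nonneg _) (hsum k)
  have hsummable₀ : Summable fun i => dist (x i) (x i.succ) := by
    simpa [dist_eq_norm] using hsummable 0
  obtain ⟨xlim, hlim⟩ := cauchySeq_tendsto_of_complete (cauchySeq_of_summable_dist hsummable₀)
  refine ⟨fun k => (hball k).1, xlim, hlim, ?_, fun k => ⟨?_, hsummable k, ?_, ?_⟩⟩
  · by_contra! hgt
    have hr_lim : Filter.Tendsto r Filter.atTop (nhds (f xlim - f xs)) :=
      ((hgrad xlim).continuousAt.tendsto.comp hlim).sub_const _
    have hL : ∀ k, f xlim - f xs ≤ r k := fun k => hr_anti.le_of_tendsto hr_lim k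
    have hL0 : 0 < f xlim - f xs := sub_pos.2 hgt
    have hL_mem : f xlim - f xs ∈ Set.Ioo 0 R := ⟨hL0, (hL 0).trans_lt (hrR 0)⟩
    have hu_lim : Filter.Tendsto u Filter.atTop (nhds 0) := by
      have h := ((hr_lim.sub (hr_lim.comp (Filter.tendsto_add_atTop_nat 1))).div_const a).sqrt
      simpa [hu_def] using h
    have hone : ∀ k, 1 ≤ b * φ' (f xlim - f xs) * u k := fun k => by
      have hpos := hL0.trans_le (hL (k + 1))
      refine (hKLstep k (hball k).2 hpos).trans ?_
      have := hanti hL_mem ⟨hpos, hrR _⟩ (hL (k + 1))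
      have := hu0 k
      gcongr
    have := ge_of_tendsto' (hu_lim.const_mul _) hone
    norm_num at this
  · change r k ≤ σ^[k] (r 0)
    induction k with
    | zero => rfl
    | succ k ih =>
      rw [Function.iterate_succ_apply']
      exact (hσstep k (hball k).2).trans
        (sigmaAlpha_mono (klAlpha_zero a b φ') (hr_nonneg k) ih)
  · simpa [dist_eq_norm] using dist_le_tsum_dist_of_tendsto hsummable₀ hlim k
  · exact Real.tsum_le_of_sum_range_le (fun _ => norm_nonneg _) (hsum k)
end

section
/- Let m ≥ 1 and for each i = 1,…,m let Ω_i ⊆ ℝ^{n_i} be a nonempty closed convex set; let Ω = Ω_1 × ⋯ × Ω_m with the Euclidean (ℓ²) product norm. Let x ∈ Ω, g = (g_{(1)},…,g_{(m)}), τ_1,…,τ_m > 0, and for each i let u_i ∈ ℝ^{n_i} be a unit vector with ⟨g_{(i)}, u_i⟩ ≥ τ_i·dist(g_{(i)}, N_{Ω_i}(x_{(i)})). Let w ∈ ℝ^m with w_i ≥ 0 for all i and w ≠ 0, define d by d_{(i)} = w_i·u_i, and assume there exists l with w_l = max_i w_i and ⟨g_{(l)}, u_l⟩ = max_i ⟨g_{(i)},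 u_i⟩. Then, with τ* = min_i τ_i, ⟨g, d⟩ ≥ (τ*/m)·dist(g, N_Ω(x))·‖d‖. -/
open scoped RealInnerProductSpace

theorem isClosed_normalCone {E : Type*} [NormedAddCommGroup E] [InnerProductSpace ℝ E]
    (Ω : Set E) (x : E) : IsClosed (normalCone Ω x) := by
  have h : normalCone Ω x = ⋂ y ∈ Ω, {v : E | ⟪v, y - x⟫ ≤ 0} := by
    ext v
    simp [normalCone]
  rw [h]
  exact isClosed_biInter fun y _ =>
    isClosed_le (continuous_id.inner continuous_const) continuous_const

theorem zero_mem_normalCone {E : Type*} [NormedAddCommGroup E] [InnerProductSpace ℝ E]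
    (Ω : Set E) (x : E) : (0 : E) ∈ normalCone Ω x := by
  intro y _
  simp

theorem mem_normalCone_pi {ι : Type*} [Fintype ι] {E : ι → Type*}
    [∀ i, NormedAddCommGroup (E i)] [∀ i, InnerProductSpace ℝ (E i)]
    {Ω : ∀ i, Set (E i)} {x v : PiLp 2 E} (h : ∀ i, v i ∈ normalCone (Ω i) (x i)) :
    v ∈ normalCone {z : PiLp 2 E | ∀ i, z i ∈ Ω i} x := by
  intro y hy
  rw [PiLp.inner_apply]
  exact Finset.sum_nonpos fun i _ => h i (y i) (hy i)

theorem PiLp.norm_le_sqrt_card_mul {ι : Type*} [Fintype ι] {E : ι → Type*}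
    [∀ i, NormedAddCommGroup (E i)] (z : PiLp 2 E) {c : ℝ} (hc : 0 ≤ c)
    (h : ∀ i, ‖z i‖ ≤ c) : ‖z‖ ≤ √(Fintype.card ι) * c := by
  refine (sq_le_sq₀ (norm_nonneg _) (by positivity)).1 ?_
  rw [mul_pow, Real.sq_sqrt (by positivity), PiLp.norm_sq_eq_of_L2]
  calc ∑ i, ‖z i‖ ^ 2 ≤ ∑ _i : ι, c ^ 2 :=
        Finset.sum_le_sum fun i _ => pow_le_pow_left₀ (norm_nonneg _) (h i) 2
    _ = Fintype.card ι * c ^ 2 := by simp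

/-- Proposition 6.7, item 2: on a product `Ω = Ω₁ × ⋯ × Ω_m` with the `ℓ²`
product norm, if in each block `uᵢ` is a unit vector with
`⟨g_{(i)}, uᵢ⟩ ≥ τᵢ·dist(g_{(i)}, N_{Ωᵢ}(x_{(i)}))`, `d_{(i)} = wᵢ·uᵢ` with `w ≥ 0`, `w ≠ 0`,
and some index `l` simultaneously maximizes `wᵢ` and `⟨g_{(i)}, uᵢ⟩`, then with
`τ* = minᵢ τᵢ`, `⟨g, d⟩ ≥ (τ*/m)·dist(g, N_Ω(x))·‖d‖`. -/
theorem product_domain_slope_bound_weighted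
    {m : ℕ} (hm : 0 < m) {dim : Fin m → ℕ}
    (Ω : ∀ i : Fin m, Set (EuclideanSpace ℝ (Fin (dim i))))
    (hne : ∀ i, (Ω i).Nonempty) (hcl : ∀ i, IsClosed (Ω i)) (hconv : ∀ i, Convex ℝ (Ω i))
    (x g : PiLp 2 (fun i : Fin m => EuclideanSpace ℝ (Fin (dim i))))
    (hx : ∀ i, x i ∈ Ω i)
    (τ : Fin m → ℝ) (hτ : ∀ i, 0 < τ i)
    (u : ∀ i : Fin m, EuclideanSpace ℝ (Fin (dim i)))
    (hu : ∀ i, ‖u i‖ = 1)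
    (hslope : ∀ i, τ i * Metric.infDist (g i) (normalCone (Ω i) (x i)) ≤ ⟪g i, u i⟫)
    (w : Fin m → ℝ) (hw0 : ∀ i, 0 ≤ w i) (hwne : w ≠ 0)
    (d : PiLp 2 (fun i : Fin m => EuclideanSpace ℝ (Fin (dim i))))
    (hd : ∀ i, d i = w i • u i)
    (l : Fin m) (hlw : ∀ i, w i ≤ w l) (hlg : ∀ i, ⟪g i, u i⟫ ≤ ⟪g l, u l⟫)
    (τstar : ℝ) (hτstar : IsLeast (Set.range τ) τstar) :
    (τstar / m) * Metric.infDist g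
        (normalCone {z : PiLp 2 (fun i : Fin m => EuclideanSpace ℝ (Fin (dim i))) |
          ∀ i, z i ∈ Ω i} x) * ‖d‖
      ≤ ⟪g, d⟫ := by
  obtain ⟨⟨j, hj⟩, hmin⟩ := hτstar
  have hpos : 0 < τstar := hj ▸ hτ j
  have hs0 : ∀ i, 0 ≤ ⟪g i, u i⟫ := fun i =>
    (mul_nonneg (hτ i).le Metric.infDist_nonneg).trans (hslope i)
  choose v hv hdist using fun i => (isClosed_normalCone (Ω i) (x i)).exists_infDist_eq_dist
    ⟨0, zero_mem_normalCone _ _⟩ (g i)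
  have hD : Metric.infDist g (normalCone {z : PiLp 2
      (fun i : Fin m => EuclideanSpace ℝ (Fin (dim i))) | ∀ i, z i ∈ Ω i} x)
      ≤ √m * (⟪g l, u l⟫ / τstar) := by
    refine (Metric.infDist_le_dist_of_mem
      (mem_normalCone_pi (v := WithLp.toLp 2 v) hv)).trans ?_
    rw [dist_eq_norm]
    have h := PiLp.norm_le_sqrt_card_mul (g - WithLp.toLp 2 v)
      (div_nonneg (hs0 l) hpos.le) fun i => by
        rw [le_div_iff₀ hpos, PiLp.sub_apply, ← dist_eq_norm, ← hdist i, mul_comm]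
        exact (mul_le_mul_of_nonneg_right (hmin ⟨i, rfl⟩) Metric.infDist_nonneg).trans
          ((hslope i).trans (hlg i))
    rwa [Fintype.card_fin] at h
  have hnorm : ‖d‖ ≤ √m * w l := by
    have h := PiLp.norm_le_sqrt_card_mul d (hw0 l) fun i => by
      rw [hd i, norm_smul, hu i, mul_one, Real.norm_of_nonneg (hw0 i)]
      exact hlw i
    rwa [Fintype.card_fin] at h
  have hinner : w l * ⟪g l, u l⟫ ≤ ⟪g, d⟫ := by
    rw [PiLp.inner_apply g d]
    simp only [hd, real_inner_smul_right]
    exact Finset.single_le_sum (f := fun i => w i * ⟪g i, u i⟫)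
      (fun i _ => mul_nonneg (hw0 i) (hs0 i)) (Finset.mem_univ l)
  have hm' : (0 : ℝ) < m := Nat.cast_pos.2 hm
  refine le_trans ?_ hinner
  calc _ ≤ τstar / m * (√m * (⟪g l, u l⟫ / τstar)) * (√m * w l) := by
        have := hs0 l
        gcongr
    _ = √m ^ 2 / m * (w l * ⟪g l, u l⟫) := by field_simp
    _ = w l * ⟪g l, u l⟫ := by rw [Real.sq_sqrt hm'.le, div_self hm'.ne', one_mul]
end
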